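/- Let Q be a symmetric 3×3 matrix with Q₁₂ ≥ 1 and Q₂₃ ≥ 1. Then the hexagon identity holds: U(jk)U((ij)k)U(ij)Q = U(ij)U(i(jk))U(jk)Q for (i,j,k)=(1,2,3), where U((ij)k) denotes unlinking the node created by U(ij) with node k, and the equality is as symmetric matrices after the canonical relabeling matching the three new nodes created on both sides. -/

import Mathlib

/-- The unlinking operation `U(ij)` on a symmetric quiver given by an `m × m` integer
adjacency matrix `Q`: it removes one pair of arrows between `i` and `j` and appends a
new node (index `m`) with arrows given by the unlinking rule. -/
def unlink {m : ℕ} (i j : Fin m) (Q : Matrix (Fin m) (Fin m) ℤ) :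
    Matrix (Fin (m + 1)) (Fin (m + 1)) ℤ :=
  Matrix.of fun a b =>
    if ha : (a : ℕ) < m then
      if hb : (b : ℕ) < m then
        let a' : Fin m := ⟨a, ha⟩
        let b' : Fin m := ⟨b, hb⟩
        if (a' = i ∧ b' = j) ∨ (a' = j ∧ b' = i) then Q a' b' - 1 else Q a' b'
      else
        let a' : Fin m := ⟨a, ha⟩
        if a' = i then Q i i + Q i j - 1
        else if a' = j then Q i j + Q j j - 1
        else Q a' i + Q a' j
    else
      if hb : (b : ℕ) < m then
        let b' : Fin m := ⟨b, hb⟩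
        if b' = i then Q i i + Q i j - 1
        else if b' = j then Q i j + Q j j - 1
        else Q b' i + Q b' j
      else Q i i + Q j j + 2 * Q i j - 1

theorem unlink_zero_one_fin_three (a b c d e f : ℤ) :
    unlink 0 1 !![a, b, c; b, d, e; c, e, f] =
      !![a, b - 1, c, a + b - 1;
         b - 1, d, e, b + d - 1;
         c, e, f, c + e;
         a + b - 1, b + d - 1, c + e, a + d + 2 * b - 1] := by
  ext i j
  fin_cases i <;> fin_cases j <;> rfl

theorem unlink_one_two_fin_three (a b c d e f : ℤ) :
    unlink 1 2 !![a, b, c; b, d, e; c, e, f] =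
      !![a, b, c, b + c;
         b, d, e - 1, d + e - 1;
         c, e - 1, f, e + f - 1;
         b + c, d + e - 1, e + f - 1, d + f + 2 * e - 1] := by
  ext i j
  fin_cases i <;> fin_cases j <;> rfl

theorem unlink_three_two_fin_four (a b c d e f g h i j : ℤ) :
    unlink 3 2 !![a, b, c, d; b, e, f, g; c, f, h, i; d, g, i, j] =
      !![a, b, c, d, d + c;
         b, e, f, g, g + f;
         c, f, h, i - 1, i + h - 1;
         d, g, i - 1, j, j + i - 1;
         d + c, g + f, i + h - 1, j + i - 1, j + h + 2 * i - 1] := by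
  ext k l
  fin_cases k <;> fin_cases l <;> rfl

theorem unlink_zero_three_fin_four (a b c d e f g h i j : ℤ) :
    unlink 0 3 !![a, b, c, d; b, e, f, g; c, f, h, i; d, g, i, j] =
      !![a, b, c, d - 1, a + d - 1;
         b, e, f, g, b + g;
         c, f, h, i, c + i;
         d - 1, g, i, j, d + j - 1;
         a + d - 1, b + g, c + i, d + j - 1, a + j + 2 * d - 1] := by
  ext k l
  fin_cases k <;> fin_cases l <;> rfl

/-- The hexagon identity for unlinking, with `(i,j,k)` the nodes `(0,1,2)` of a
three-node symmetric quiver: `U(jk) U((ij)k) U(ij) Q = U(ij) U(i(jk)) U(jk) Q`.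
On the left the node created by `U(ij)` has index `3`, by `U((ij)k)` index `4`,
by `U(jk)` index `5`; on the right the node `(jk)` has index `3`, `(i(jk))` index `4`
and `(ij)` index `5`.  The canonical relabeling matching the new nodes on both sides
is therefore the transposition of the indices `3` and `5`. -/
theorem unlink_hexagon (Q : Matrix (Fin 3) (Fin 3) ℤ) (hQ : Q.IsSymm)
    (h12 : 1 ≤ Q 0 1) (h23 : 1 ≤ Q 1 2) :
    unlink (1 : Fin 5) (2 : Fin 5)
        (unlink (3 : Fin 4) (2 : Fin 4) (unlink (0 : Fin 3) (1 : Fin 3) Q)) =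
      (unlink (0 : Fin 5) (1 : Fin 5)
          (unlink (0 : Fin 4) (3 : Fin 4) (unlink (1 : Fin 3) (2 : Fin 3) Q))).submatrix
        (Equiv.swap (3 : Fin 6) (5 : Fin 6)) (Equiv.swap (3 : Fin 6) (5 : Fin 6)) := by
  have h10 : Q 1 0 = Q 0 1 := hQ.apply 0 1
  have h20 : Q 2 0 = Q 0 2 := hQ.apply 0 2
  have h21 : Q 2 1 = Q 1 2 := hQ.apply 1 2
  have hQ' : Q = !![Q 0 0, Q 0 1, Q 0 2; Q 0 1, Q 1 1, Q 1 2; Q 0 2, Q 1 2, Q 2 2] := by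
    conv_lhs => rw [Matrix.eta_fin_three Q, h10, h20, h21]
  rw [hQ', unlink_zero_one_fin_three, unlink_one_two_fin_three, unlink_three_two_fin_four,
    unlink_zero_three_fin_four]
  generalize Q 0 0 = a, Q 0 1 = b, Q 0 2 = c, Q 1 1 = d, Q 1 2 = e, Q 2 2 = f
  ext i j
  fin_cases i <;> fin_cases j <;>
    simp [unlink, Equiv.swap_apply_def] <;> ring
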